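/- Let n ≥ 2, let X and Y be real n-normed spaces with n-norms N_X and N_Y, and let φ : X → Y be a surjective map satisfying the (nSDOPP) property: for all x₀,x₁,…,xₙ ∈ X, N_X(x₁−x₀,…,xₙ−x₀) = 1 if and only if N_Y(φ(x₁)−φ(x₀),…,φ(xₙ)−φ(x₀)) = 1. Then φ is injective, φ is affine (it preserves all affine combinations: φ(t·x + (1−t)·y) = t·φ(x) + (1−t)·φ(y) for all x,y ∈ X and t ∈ ℝ), and φ is an n-isometry. -/

import Mathlib

/-- An `n`-norm on a real vector space `X`: a nonnegative `n`-variable function that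
vanishes exactly on linearly dependent tuples, is symmetric under permutations,
is absolutely homogeneous in each variable, and is subadditive in each variable. -/
structure IsNNorm (n : ℕ) (X : Type*) [AddCommGroup X] [Module ℝ X]
    (N : (Fin n → X) → ℝ) : Prop where
  nonneg : ∀ v : Fin n → X, 0 ≤ N v
  eq_zero_iff : ∀ v : Fin n → X, N v = 0 ↔ ¬ LinearIndependent ℝ v
  perm : ∀ (v : Fin n → X) (σ : Equiv.Perm (Fin n)), N (v ∘ σ) = N v
  smul : ∀ (v : Fin n → X) (i : Fin n) (α : ℝ),
    N (Function.update v i (α • v i)) = |α| * N v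
  add_le : ∀ (v : Fin n → X) (i : Fin n) (y : X),
    N (Function.update v i (v i + y)) ≤ N v + N (Function.update v i y)

namespace IsNNorm

open Matrix

section

variable {m : ℕ} {X : Type*} [AddCommGroup X] [Module ℝ X] {N : (Fin (m + 2) → X) → ℝ}

theorem vecCons_smul (h : IsNNorm (m + 2) X N) (c : ℝ) (a b : X) (w : Fin m → X) :
    N (vecCons a (vecCons (c • b) w)) = |c| * N (vecCons a (vecCons b w)) := by
  rw [← h.smul _ 1 c]
  congr 1
  ext i
  refine Fin.cases ?_ (fun i => Fin.cases ?_ (fun i => ?_) i) i <;>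
    simp [Function.update, Fin.ext_iff]

theorem vecCons_add_le (h : IsNNorm (m + 2) X N) (a b c : X) (w : Fin m → X) :
    N (vecCons a (vecCons (b + c) w)) ≤
      N (vecCons a (vecCons b w)) + N (vecCons a (vecCons c w)) := by
  convert h.add_le (vecCons a (vecCons b w)) 1 c using 3
  all_goals
    ext i
    refine Fin.cases ?_ (fun i => Fin.cases ?_ (fun i => ?_) i) i <;>
      simp [Function.update, Fin.ext_iff]

theorem vecCons_swap (h : IsNNorm (m + 2) X N) (a b : X) (w : Fin m → X) :
    N (vecCons a (vecCons b w)) = N (vecCons b (vecCons a w)) := by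
  rw [← h.perm _ (Equiv.swap 0 1)]
  congr 1
  ext i
  refine Fin.cases ?_ (fun i => Fin.cases ?_ (fun i => ?_) i) i <;>
    simp [Equiv.swap_apply_def, Fin.ext_iff]

theorem vecCons_self (h : IsNNorm (m + 2) X N) (a : X) (w : Fin m → X) :
    N (vecCons a (vecCons a w)) = 0 := by
  rw [h.eq_zero_iff]
  intro hl
  have := hl.injective (a₁ := 0) (a₂ := 1) (by simp)
  simp at this

theorem vecCons_smul_self (h : IsNNorm (m + 2) X N) (c : ℝ) (a : X) (w : Fin m → X) :
    N (vecCons a (vecCons (c • a) w)) = 0 := by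
  rw [h.vecCons_smul, h.vecCons_self, mul_zero]

theorem vecCons_shear (h : IsNNorm (m + 2) X N) (c : ℝ) (a b : X) (w : Fin m → X) :
    N (vecCons a (vecCons (b + c • a) w)) = N (vecCons a (vecCons b w)) := by
  apply le_antisymm
  · simpa [h.vecCons_smul_self] using h.vecCons_add_le a b (c • a) w
  · have := h.vecCons_add_le a (b + c • a) ((-c) • a) w
    rwa [h.vecCons_smul_self, add_zero, neg_smul, add_neg_cancel_right] at this

theorem exists_vecCons_pos (h : IsNNorm (m + 2) X N)
    (hd : ((m + 2 : ℕ) : Cardinal) ≤ Module.rank ℝ X) {a b : X} (ha : a ≠ 0)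
    (hab : ∀ c : ℝ, c • a ≠ b) : ∃ w : Fin m → X, 0 < N (vecCons a (vecCons b w)) := by
  have key : ∀ k ≤ m, ∃ w : Fin k → X, LinearIndependent ℝ (vecCons a (vecCons b w)) := by
    intro k
    induction k with
    | zero =>
      intro _
      refine ⟨![], (LinearIndependent.pair_iff' ha).2 hab⟩
    | succ k ih =>
      intro hk
      obtain ⟨w, hw⟩ := ih (by omega)
      obtain ⟨x, hx⟩ := exists_linearIndependent_snoc_of_lt_rank hw
        (lt_of_lt_of_le (by exact_mod_cast (by omega : k + 2 < m + 2)) hd)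
      refine ⟨Fin.snoc w x, ?_⟩
      simpa only [vecCons, Fin.cons_snoc_eq_snoc_cons] using hx
  obtain ⟨w, hw⟩ := key m le_rfl
  exact ⟨w, (h.nonneg _).lt_of_ne' fun h0 => (h.eq_zero_iff _).1 h0 hw⟩

theorem exists_smul_ne (hd : ((m + 2 : ℕ) : Cardinal) ≤ Module.rank ℝ X) {a : X} (ha : a ≠ 0) :
    ∃ b : X, ∀ c : ℝ, c • a ≠ b := by
  obtain ⟨b, hb⟩ := exists_linearIndependent_pair_of_one_lt_rank
    (lt_of_lt_of_le (by exact_mod_cast (by omega : 1 < m + 2)) hd) ha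
  exact ⟨b, (LinearIndependent.pair_iff' ha).1 hb⟩

theorem exists_vecCons_smul_eq_one (h : IsNNorm (m + 2) X N)
    (hd : ((m + 2 : ℕ) : Cardinal) ≤ Module.rank ℝ X) {a b : X} (ha : a ≠ 0)
    (hab : ∀ c : ℝ, c • a ≠ b) :
    ∃ r : ℝ, 0 < r ∧ ∃ w : Fin m → X, N (vecCons a (vecCons (r • b) w)) = 1 := by
  obtain ⟨w, hw⟩ := h.exists_vecCons_pos hd ha hab
  refine ⟨(N (vecCons a (vecCons b w)))⁻¹, by positivity, w, ?_⟩
  rw [h.vecCons_smul, abs_of_pos (by positivity), inv_mul_cancel₀ hw.ne']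

theorem exists_vecCons_eq_one (h : IsNNorm (m + 2) X N)
    (hd : ((m + 2 : ℕ) : Cardinal) ≤ Module.rank ℝ X) {a : X} (ha : a ≠ 0) :
    ∃ (b : X) (w : Fin m → X), N (vecCons a (vecCons b w)) = 1 := by
  obtain ⟨b, hb⟩ := exists_smul_ne hd ha
  obtain ⟨r, -, w, hw⟩ := h.exists_vecCons_smul_eq_one hd ha hb
  exact ⟨_, w, hw⟩

theorem eq_or_eq_neg (h : IsNNorm (m + 2) X N)
    (hd : ((m + 2 : ℕ) : Cardinal) ≤ Module.rank ℝ X) {a c : X} (ha : a ≠ 0)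
    (hac : ∀ (b : X) (w : Fin m → X),
      N (vecCons a (vecCons b w)) = 1 ↔ N (vecCons c (vecCons b w)) = 1) :
    c = a ∨ c = -a := by
  by_cases hli : ∀ t : ℝ, t • a ≠ c
  · exfalso
    obtain ⟨r, hr, w, hw⟩ := h.exists_vecCons_smul_eq_one hd ha hli
    have h1 := (hac (r • c + (2 * r) • a) w).1 (by rw [h.vecCons_shear, hw])
    rw [add_comm (r • c), h.vecCons_shear, h.vecCons_smul, h.vecCons_swap, abs_mul, mul_assoc,
      ← h.vecCons_smul, hw] at h1
    norm_num at h1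
  · push Not at hli
    obtain ⟨t, rfl⟩ := hli
    obtain ⟨b, w, hw⟩ := h.exists_vecCons_eq_one hd ha
    have h1 := (hac b w).1 hw
    rw [h.vecCons_swap, h.vecCons_smul, h.vecCons_swap, hw, mul_one] at h1
    rcases (abs_eq zero_le_one).1 h1 with rfl | rfl <;> simp

end

section

variable {m : ℕ} {X Y : Type*} [AddCommGroup X] [Module ℝ X] [AddCommGroup Y] [Module ℝ Y]
  {NX : (Fin (m + 2) → X) → ℝ} {NY : (Fin (m + 2) → Y) → ℝ}

/-- An additive bijection preserving the relation `N = 1` in both directions is homogeneous. -/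
theorem map_smul_of_eq_one_iff (hNX : IsNNorm (m + 2) X NX) (hNY : IsNNorm (m + 2) Y NY)
    (hdX : ((m + 2 : ℕ) : Cardinal) ≤ Module.rank ℝ X)
    (hdY : ((m + 2 : ℕ) : Cardinal) ≤ Module.rank ℝ Y)
    (ψ : X →+ Y) (hinj : Function.Injective ψ) (hsurj : Function.Surjective ψ)
    (hψ : ∀ (a b : X) (w : Fin m → X), NX (vecCons a (vecCons b w)) = 1 ↔
      NY (vecCons (ψ a) (vecCons (ψ b) (ψ ∘ w))) = 1) (s : ℝ) (u : X) :
    ψ (s • u) = s • ψ u := by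
  have hne : ∀ {u : X}, u ≠ 0 → ψ u ≠ 0 := fun hu => (map_ne_zero_iff ψ hinj).2 hu
  have hline : ∀ (u : X) (s : ℝ), ∃ t : ℝ, u ≠ 0 → ψ (s • u) = t • ψ u := by
    intro u s
    by_cases hu : u = 0
    · exact ⟨0, fun h => (h hu).elim⟩
    by_contra! hcon
    obtain ⟨r, hr, w', hw'⟩ := hNY.exists_vecCons_smul_eq_one hdY (hne hu)
      (b := ψ (s • u)) fun c hc => (hcon c).2 hc.symm
    obtain ⟨v, hv⟩ := hsurj (r • ψ (s • u))
    obtain ⟨w, rfl⟩ := hsurj.comp_left w'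
    have h1 := hw'
    rw [← hv, ← hψ, ← hNX.vecCons_shear s, hψ, map_add, hv,
      show r • ψ (s • u) + ψ (s • u) = (r + 1) • ψ (s • u) by module,
      hNY.vecCons_smul, abs_of_pos (by positivity)] at h1
    rw [hNY.vecCons_smul, abs_of_pos hr] at hw'
    nlinarith
  choose f hf using hline
  have hindep : ∀ {u v : X}, u ≠ 0 → v ≠ 0 → (∀ c : ℝ, c • u ≠ v) →
      ∀ c : ℝ, c • ψ u ≠ ψ v := by
    intro u v hu hv huv c hc
    obtain ⟨r, -, w, hw⟩ := hNX.exists_vecCons_smul_eq_one hdX hu huv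
    rw [hψ, hf v r hv, ← hc, smul_smul, hNY.vecCons_smul_self] at hw
    exact zero_ne_one hw
  have hpair : ∀ {u v : X}, u ≠ 0 → (∀ c : ℝ, c • u ≠ v) → ∀ s, f u s = f v s := by
    intro u v hu huv s
    have hv : v ≠ 0 := fun h0 => huv 0 (by simp [h0])
    have huv0 : u + v ≠ 0 := fun h0 => huv (-1) (by simpa using neg_eq_of_add_eq_zero_right h0)
    have e1 := hf (u + v) s huv0
    rw [smul_add, map_add, map_add, hf u s hu, hf v s hv] at e1
    have hli := (LinearIndependent.pair_iff' (hne hu)).2 (hindep hu hv huv)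
    rw [LinearIndependent.pair_iff] at hli
    have := hli (f u s - f (u + v) s) (f v s - f (u + v) s) (by
      rw [sub_smul, sub_smul, sub_add_sub_comm, e1, smul_add, sub_self])
    linarith [this.1, this.2]
  by_cases hu : u = 0
  · simp [hu]
  obtain ⟨v, hv⟩ := exists_smul_ne hdX hu
  have hscale : ∀ t : ℝ, t ≠ 0 → ∀ s, f (t • u) s = f u s := by
    intro t ht s
    rw [hpair hu hv s]
    refine hpair (smul_ne_zero ht hu) (fun c hc => hv (c * t) ?_) s
    rw [← hc, smul_smul]
  have hcancel : ∀ {a b : ℝ}, a • ψ u = b • ψ u → a = b := fun hab =>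
    smul_left_injective ℝ (hne hu) hab
  let F : ℝ →+* ℝ :=
    { toFun := f u
      map_one' := hcancel (by rw [← hf u 1 hu, one_smul, one_smul])
      map_zero' := hcancel (by rw [← hf u 0 hu, zero_smul, zero_smul, map_zero])
      map_add' := fun x y => hcancel (by
        rw [← hf u _ hu, add_smul, add_smul, map_add, hf u x hu, hf u y hu])
      map_mul' := fun x y => hcancel (by
        by_cases hy : y = 0
        · subst hy
          have h0 : f u 0 = 0 := hcancel (by rw [← hf u 0 hu, zero_smul, zero_smul, map_zero])
          simp [h0]
        · rw [← hf u _ hu, mul_smul, mul_smul, hf _ x (smul_ne_zero hy hu), hscale y hy,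
            hf u y hu]) }
  have hF : f u s = s := congrArg (fun G : ℝ →+* ℝ => G s) (Subsingleton.elim F (RingHom.id ℝ))
  rw [hf u s hu, hF]

/-- A homogeneous map preserving the relation `N = 1` in both directions preserves `N`. -/
theorem map_eq_of_eq_one_iff (hNX : IsNNorm (m + 2) X NX) (hNY : IsNNorm (m + 2) Y NY)
    (ψ : X → Y) (hsmul : ∀ (s : ℝ) (u : X), ψ (s • u) = s • ψ u)
    (hψ : ∀ v : Fin (m + 2) → X, NX v = 1 ↔ NY (ψ ∘ v) = 1) (v : Fin (m + 2) → X) :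
    NY (ψ ∘ v) = NX v := by
  have key : ∀ c : ℝ, |c| * NX v = 1 ↔ |c| * NY (ψ ∘ v) = 1 := by
    intro c
    rw [← hNX.smul v 0 c, ← hNY.smul (ψ ∘ v) 0 c, hψ, Function.comp_update, hsmul]
    rfl
  rcases (hNX.nonneg v).eq_or_lt' with h0 | h0
  · by_contra hne
    have h1 := (key (NY (ψ ∘ v))⁻¹).2 (by
      rw [abs_of_nonneg (inv_nonneg.2 (hNY.nonneg _)), inv_mul_cancel₀ (h0 ▸ hne)])
    simp [h0] at h1
  · have h1 := (key (NX v)⁻¹).1 (by rw [abs_of_pos (by positivity), inv_mul_cancel₀ h0.ne'])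
    rw [abs_of_pos (by positivity)] at h1
    field_simp at h1
    exact h1

/-- A surjection preserving unit `n`-distance in both directions is injective. -/
theorem injective_of_eq_one_iff (hNX : IsNNorm (m + 2) X NX) (hNY : IsNNorm (m + 2) Y NY)
    (hdX : ((m + 2 : ℕ) : Cardinal) ≤ Module.rank ℝ X) (φ : X → Y)
    (hφ : ∀ (o a b : X) (w : Fin m → X), NX (vecCons a (vecCons b w)) = 1 ↔
      NY (vecCons (φ (o + a) - φ o) (vecCons (φ (o + b) - φ o)
        (fun i => φ (o + w i) - φ o))) = 1) : Function.Injective φ := by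
  intro x y hxy
  by_contra hne
  obtain ⟨b, w, hw⟩ := hNX.exists_vecCons_eq_one hdX (sub_ne_zero.2 (Ne.symm hne))
  rw [hφ x, add_sub_cancel, hxy, sub_self, hNY.vecCons_swap, ← zero_smul ℝ (φ (x + b) - φ y),
    hNY.vecCons_smul_self] at hw
  exact zero_ne_one hw

/-- A bijection preserving unit `n`-distance in both directions preserves midpoints. -/
theorem map_add_sub_of_eq_one_iff (hNX : IsNNorm (m + 2) X NX) (hNY : IsNNorm (m + 2) Y NY)
    (hdY : ((m + 2 : ℕ) : Cardinal) ≤ Module.rank ℝ Y)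
    (φ : X → Y) (hinj : Function.Injective φ) (hsurj : Function.Surjective φ)
    (hφ : ∀ (o a b : X) (w : Fin m → X), NX (vecCons a (vecCons b w)) = 1 ↔
      NY (vecCons (φ (o + a) - φ o) (vecCons (φ (o + b) - φ o)
        (fun i => φ (o + w i) - φ o))) = 1) (p a : X) :
    φ (p - a) - φ p = -(φ (p + a) - φ p) := by
  by_cases ha : a = 0
  · simp [ha]
  refine (hNY.eq_or_eq_neg hdY (a := φ (p + a) - φ p) (c := φ (p - a) - φ p) ?_ ?_).resolve_left ?_
  · rw [sub_ne_zero]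
    exact fun h => ha (by simpa using hinj h)
  · intro b' w'
    have hs : Function.Surjective fun x => φ (p + x) - φ p := fun y => by
      obtain ⟨x, hx⟩ := hsurj (y + φ p)
      exact ⟨x - p, by simp [hx]⟩
    obtain ⟨b, rfl⟩ := hs b'
    obtain ⟨w, rfl⟩ := hs.comp_left w'
    have h1 := hφ p a b w
    have h2 := hφ p (-a) b w
    rw [← neg_one_smul ℝ a, hNX.vecCons_swap, hNX.vecCons_smul, hNX.vecCons_swap, neg_one_smul,
      ← sub_eq_add_neg] at h2
    simp only [abs_neg, abs_one, one_mul] at h2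
    exact h1.symm.trans h2
  · intro h
    have h1 : -a = a := by simpa [sub_eq_add_neg] using hinj (sub_left_injective h)
    rw [neg_eq_iff_add_eq_zero, ← two_smul ℝ] at h1
    exact ha ((smul_eq_zero.1 h1).resolve_left two_ne_zero)

end

end IsNNorm

/-- A surjective map between real `n`-normed spaces (`n ≥ 2`) which preserves unit
`n`-distance in both directions is injective, affine, and an `n`-isometry. -/
theorem nSDOPP_surjective_affine_nIsometry
    {n : ℕ} (hn : 2 ≤ n)
    {X Y : Type*} [AddCommGroup X] [Module ℝ X] [AddCommGroup Y] [Module ℝ Y]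
    (NX : (Fin n → X) → ℝ) (NY : (Fin n → Y) → ℝ)
    (hNX : IsNNorm n X NX) (hNY : IsNNorm n Y NY)
    (hdX : (n : Cardinal) ≤ Module.rank ℝ X) (hdY : (n : Cardinal) ≤ Module.rank ℝ Y)
    (φ : X → Y) (hsurj : Function.Surjective φ)
    (hφ : ∀ x : Fin (n + 1) → X,
      NX (fun i : Fin n => x i.succ - x 0) = 1 ↔
      NY (fun i : Fin n => φ (x i.succ) - φ (x 0)) = 1) :
    Function.Injective φ ∧
    (∀ (x y : X) (t : ℝ), φ (t • x + (1 - t) • y) = t • φ x + (1 - t) • φ y) ∧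
    (∀ x : Fin (n + 1) → X,
      NY (fun i : Fin n => φ (x i.succ) - φ (x 0)) =
      NX (fun i : Fin n => x i.succ - x 0)) := by
  obtain ⟨m, rfl⟩ := Nat.exists_eq_add_of_le' hn
  have hbase : ∀ (o : X) (v : Fin (m + 2) → X),
      NX v = 1 ↔ NY (fun i => φ (o + v i) - φ o) = 1 := fun o v => by
    simpa using hφ (Fin.cons o fun i => o + v i)
  have hpair : ∀ (o a b : X) (w : Fin m → X),
      NX (Matrix.vecCons a (Matrix.vecCons b w)) = 1 ↔
      NY (Matrix.vecCons (φ (o + a) - φ o) (Matrix.vecCons (φ (o + b) - φ o)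
        (fun i => φ (o + w i) - φ o))) = 1 := fun o a b w => by
    rw [hbase o]
    congr! 2
    ext i
    refine Fin.cases ?_ (fun i => Fin.cases ?_ (fun i => ?_) i) i <;> simp
  have hinj := hNX.injective_of_eq_one_iff hNY hdX φ hpair
  have hmid := hNX.map_add_sub_of_eq_one_iff hNY hdY φ hinj hsurj hpair
  have hsum : ∀ x y : X, φ x + φ y = φ ((2⁻¹ : ℝ) • (x + y)) + φ ((2⁻¹ : ℝ) • (x + y)) := by
    intro x y
    have h := hmid ((2⁻¹ : ℝ) • (x + y)) ((2⁻¹ : ℝ) • (x - y))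
    have e1 : (2⁻¹ : ℝ) • (x + y) - (2⁻¹ : ℝ) • (x - y) = y := by module
    have e2 : (2⁻¹ : ℝ) • (x + y) + (2⁻¹ : ℝ) • (x - y) = x := by module
    rw [e1, e2, sub_eq_iff_eq_add] at h
    rw [h]
    abel
  let ψ : X →+ Y :=
    { toFun := fun x => φ x - φ 0
      map_zero' := sub_self _
      map_add' := fun x y => by
        have h := (hsum x y).trans (by simpa using (hsum (x + y) 0).symm)
        rw [sub_add_sub_comm, h]
        abel }
  have hsmul : ∀ (s : ℝ) (u : X), ψ (s • u) = s • ψ u :=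
    hNX.map_smul_of_eq_one_iff hNY hdX hdY ψ
      (fun x y hxy => hinj (sub_left_injective hxy))
      (fun y => (hsurj (y + φ 0)).imp fun x hx => by simp [ψ, hx])
      (fun a b w => by simpa [ψ, Function.comp_def] using hpair 0 a b w)
  have hφψ : ∀ x, φ x = ψ x + φ 0 := fun x => (sub_add_cancel _ _).symm
  refine ⟨hinj, fun x y t => ?_, fun x => ?_⟩
  · rw [hφψ, hφψ x, hφψ y, map_add, hsmul, hsmul]
    module
  · rw [← hNX.map_eq_of_eq_one_iff hNY ψ hsmul
      (fun v => by simpa [ψ, Function.comp_def] using hbase 0 v)]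
    congr 1
    ext i
    rw [Function.comp_apply, map_sub, hφψ, hφψ (x 0)]
    abel
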